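/- Let K : ℤ → ℝ be even and absolutely summable with spectrum S(f) = Σ_{m∈ℤ} K(m) e^{−2πi f m} satisfying 0 < c ≤ S(f) ≤ M for all f ∈ [0,1]. Let Λ^{(n)} be the n×n symmetric Toeplitz matrix with entries Λ^{(n)}_{ij} = K(i−j) (which is then positive definite). Then (1/n) · ln det(Λ^{(n)}) → ∫₀¹ ln(S(f)) df as n → ∞. -/

import Mathlib

open MeasureTheory Filter Matrix

/-- The spectrum `S(f) = Σ_{m ∈ ℤ} K(m) e^{-2πi f m}` of an even, absolutely summable
auto-covariance function `K : ℤ → ℝ`; by evenness it equals the real cosine series. -/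
noncomputable def spectrum' (K : ℤ → ℝ) (f : ℝ) : ℝ :=
  ∑' m : ℤ, K m * Real.cos (2 * Real.pi * f * (m : ℝ))

/-- The `n × n` symmetric Toeplitz matrix with entries `K(i - j)`. -/
def toeplitz (K : ℤ → ℝ) (n : ℕ) : Matrix (Fin n) (Fin n) ℝ :=
  fun i j => K ((i : ℤ) - (j : ℤ))

theorem sum_exp_two_pi {N : ℕ} (hN : N ≠ 0) (m : ℤ) :
    ∑ k : Fin N, Complex.exp ((2 * Real.pi * ((k : ℝ) / N) * m : ℝ) * Complex.I) =
      if (N : ℤ) ∣ m then (N : ℂ) else 0 := by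
  have hN' : (N : ℂ) ≠ 0 := Nat.cast_ne_zero.mpr hN
  set w : ℂ := Complex.exp (2 * Real.pi * Complex.I * (m / N)) with hw
  have hpow (k : ℕ) :
      Complex.exp ((2 * Real.pi * ((k : ℝ) / N) * m : ℝ) * Complex.I) = w ^ k := by
    rw [hw, ← Complex.exp_nat_mul]
    congr 1
    push_cast
    ring
  simp_rw [hpow]
  rw [Fin.sum_univ_eq_sum_range (fun k => w ^ k) N]
  split_ifs with h
  · obtain ⟨q, rfl⟩ := h
    have : w = 1 := by
      rw [hw, Complex.exp_eq_one_iff]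
      exact ⟨q, by push_cast; field_simp⟩
    simp [this]
  · have hw1 : w ≠ 1 := by
      rw [hw, Ne, Complex.exp_eq_one_iff]
      rintro ⟨q, hq⟩
      apply h
      refine ⟨q, ?_⟩
      have h2 : (2 * Real.pi * Complex.I : ℂ) ≠ 0 := Complex.two_pi_I_ne_zero
      have h3 : (m / N : ℂ) = q := by
        apply mul_left_cancel₀ h2
        rw [hq]; ring
      rw [div_eq_iff hN'] at h3
      have : (m : ℂ) = ((N * q : ℤ) : ℂ) := by rw [h3]; push_cast; ring
      exact_mod_cast this
    have hwN : w ^ N = 1 := by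
      rw [hw, ← Complex.exp_nat_mul, Complex.exp_eq_one_iff]
      exact ⟨m, by field_simp⟩
    have := mul_geom_sum w N
    rw [hwN, sub_self] at this
    exact (mul_eq_zero.mp this).resolve_left (sub_ne_zero.mpr hw1)

theorem sum_cos_two_pi {N : ℕ} (hN : N ≠ 0) (m : ℤ) :
    ∑ k : Fin N, Real.cos (2 * Real.pi * ((k : ℝ) / N) * m) =
      if (N : ℤ) ∣ m then (N : ℝ) else 0 := by
  have h := congrArg Complex.re (sum_exp_two_pi hN m)
  rw [Complex.re_sum] at h
  simp_rw [Complex.exp_ofReal_mul_I_re] at h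
  rw [h]
  split_ifs <;> simp

theorem sum_sin_two_pi {N : ℕ} (hN : N ≠ 0) (m : ℤ) :
    ∑ k : Fin N, Real.sin (2 * Real.pi * ((k : ℝ) / N) * m) = 0 := by
  have h := congrArg Complex.im (sum_exp_two_pi hN m)
  rw [Complex.im_sum] at h
  simp_rw [Complex.exp_ofReal_mul_I_im] at h
  rw [h]
  split_ifs <;> simp

theorem log_det_le_trace_sub_card {ι : Type*} [Fintype ι] [DecidableEq ι] {P : Matrix ι ι ℝ}
    (hP : P.PosDef) : Real.log P.det ≤ P.trace - Fintype.card ι := by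
  have hd := hP.1.det_eq_prod_eigenvalues
  have ht := hP.1.trace_eq_sum_eigenvalues
  simp only [RCLike.ofReal_real_eq_id, id] at hd ht
  rw [hd, ht, Real.log_prod fun i _ => (hP.eigenvalues_pos i).ne']
  calc _ ≤ ∑ i, (hP.1.eigenvalues i - 1) :=
        Finset.sum_le_sum fun i _ => Real.log_le_sub_one_of_pos (hP.eigenvalues_pos i)
    _ = _ := by simp

open scoped MatrixOrder Matrix.Norms.L2Operator in
theorem log_det_sub_le_trace {ι : Type*} [Fintype ι] [DecidableEq ι] {A B : Matrix ι ι ℝ}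
    (hA : A.PosDef) (hB : B.PosDef) :
    Real.log A.det - Real.log B.det ≤ (B⁻¹ * (A - B)).trace := by
  obtain ⟨R, hR⟩ := CStarAlgebra.nonneg_iff_eq_star_mul_self.mp hB.inv.posSemidef.nonneg
  rw [star_eq_conjTranspose] at hR
  have hu : IsUnit B.det := hB.det_pos.ne'.isUnit
  have hdet : R.det * R.det = B.det⁻¹ := by
    have := congrArg det hR
    rw [det_mul, det_conjTranspose, det_nonsing_inv, Ring.inverse_eq_inv'] at this
    simpa using this.symm
  have hRu : IsUnit R := by
    rw [isUnit_iff_isUnit_det, isUnit_iff_ne_zero]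
    intro h
    rw [h, zero_mul] at hdet
    exact inv_ne_zero hB.det_pos.ne' hdet.symm
  have hP : (R * A * Rᴴ).PosDef :=
    hA.mul_mul_conjTranspose_same (vecMul_injective_of_isUnit hRu)
  have h := log_det_le_trace_sub_card hP
  have h1 : (R * A * Rᴴ).det = A.det * B.det⁻¹ := by
    rw [det_mul, det_mul, det_conjTranspose, ← hdet]
    simp
    ring
  have h2 : (R * A * Rᴴ).trace = (B⁻¹ * A).trace := by
    rw [trace_mul_comm, ← Matrix.mul_assoc, hR]
  rw [h1, h2, Real.log_mul hA.det_pos.ne' (inv_ne_zero hB.det_pos.ne'), Real.log_inv] at h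
  rw [Matrix.mul_sub, trace_sub, nonsing_inv_mul _ hu, trace_one]
  linarith

theorem abs_inv_apply_le {ι : Type*} [Fintype ι] [DecidableEq ι] {B : Matrix ι ι ℝ} {c : ℝ}
    (hc : 0 < c) (hu : IsUnit B.det) (hB : ∀ x, c * (x ⬝ᵥ x) ≤ x ⬝ᵥ B *ᵥ x) (i j : ι) :
    |B⁻¹ i j| ≤ c⁻¹ := by
  set u : ι → ℝ := B⁻¹ *ᵥ Pi.single j 1 with hu'
  have huj (i : ι) : B⁻¹ i j = u i := by simp [hu']
  have hBu : B *ᵥ u = Pi.single j 1 := by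
    rw [hu', mulVec_mulVec, mul_nonsing_inv _ hu, one_mulVec]
  have h := hB u
  rw [hBu, dotProduct_single, mul_one] at h
  have hs (i : ι) : u i ^ 2 ≤ u ⬝ᵥ u := by
    rw [sq]
    exact Finset.single_le_sum (f := fun k => u k * u k) (fun k _ => mul_self_nonneg _)
      (Finset.mem_univ i)
  have hj : u j ≤ c⁻¹ := by
    rw [← one_div, le_div_iff₀ hc]
    by_contra! hlt
    nlinarith [mul_le_mul_of_nonneg_left (hs j) hc.le]
  rw [huj]
  refine abs_le_of_sq_le_sq ?_ (inv_nonneg.mpr hc.le)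
  have h5 : c * u i ^ 2 ≤ c⁻¹ := (mul_le_mul_of_nonneg_left (hs i) hc.le).trans (h.trans hj)
  rw [← le_inv_mul_iff₀ hc] at h5
  rwa [sq c⁻¹]

theorem log_det_sub_le_sum_abs {ι : Type*} [Fintype ι] [DecidableEq ι] {A B : Matrix ι ι ℝ} {c : ℝ}
    (hc : 0 < c) (hA : A.PosDef) (hB : B.PosDef) (hBc : ∀ x, c * (x ⬝ᵥ x) ≤ x ⬝ᵥ B *ᵥ x) :
    Real.log A.det - Real.log B.det ≤ c⁻¹ * ∑ i, ∑ j, |A i j - B i j| := by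
  refine (log_det_sub_le_trace hA hB).trans ?_
  rw [Finset.sum_comm, Finset.mul_sum, trace]
  refine Finset.sum_le_sum fun i _ => ?_
  rw [diag_apply, mul_apply, Finset.mul_sum]
  refine Finset.sum_le_sum fun j _ => (le_abs_self _).trans ?_
  rw [abs_mul, Matrix.sub_apply]
  exact mul_le_mul_of_nonneg_right (abs_inv_apply_le hc hB.det_pos.ne'.isUnit hBc i j)
    (abs_nonneg _)

theorem posDef_of_le {ι : Type*} [Fintype ι] {B : Matrix ι ι ℝ} {c : ℝ}
    (hc : 0 < c) (hs : B.IsSymm) (hB : ∀ x, c * (x ⬝ᵥ x) ≤ x ⬝ᵥ B *ᵥ x) : B.PosDef := by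
  refine PosDef.of_dotProduct_mulVec_pos
    ((conjTranspose_eq_transpose_of_trivial B).trans hs) fun x hx => ?_
  refine lt_of_lt_of_le (mul_pos hc ?_) (by simpa using hB x)
  exact lt_of_le_of_ne (by simpa using dotProduct_self_star_nonneg x)
    (by simpa [eq_comm] using hx)

theorem tendsto_riemann_sum {g : ℝ → ℝ} (hg : ContinuousOn g (Set.Icc 0 1)) :
    Tendsto (fun n : ℕ => (∑ k : Fin n, g ((k : ℝ) / n)) / n) atTop
      (nhds (∫ x in (0 : ℝ)..1, g x)) := by
  rw [Metric.tendsto_atTop]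
  intro ε hε
  obtain ⟨δ, hδ, hgδ⟩ := Metric.uniformContinuousOn_iff.mp
    (isCompact_Icc.uniformContinuousOn_of_continuous hg) (ε / 2) (half_pos hε)
  obtain ⟨n₀, hn₀⟩ := exists_nat_gt δ⁻¹
  refine ⟨max n₀ 1, fun n hn => ?_⟩
  have hn1 : 1 ≤ n := le_of_max_le_right hn
  have hn0 : (0 : ℝ) < n := by exact_mod_cast hn1
  have hnδ : (n : ℝ)⁻¹ < δ := by
    rw [inv_lt_comm₀ hn0 hδ]
    exact hn₀.trans_le (by exact_mod_cast le_of_max_le_left hn)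
  set a : ℕ → ℝ := fun k => (k : ℝ) / n with ha
  have hstep (k : ℕ) : a (k + 1) - a k = (n : ℝ)⁻¹ := by
    simp only [ha]; push_cast; ring
  have hle (k : ℕ) : a k ≤ a (k + 1) := by
    linarith [hstep k, inv_pos.mpr hn0]
  have hsub (k : ℕ) (hk : k < n) : Set.Icc (a k) (a (k + 1)) ⊆ Set.Icc 0 1 := by
    refine Set.Icc_subset_Icc (by positivity) ?_
    simp only [ha]
    rw [div_le_one hn0]
    exact_mod_cast hk
  have hint (k : ℕ) (hk : k < n) : IntervalIntegrable g volume (a k) (a (k + 1)) :=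
    (hg.mono (by rw [Set.uIcc_of_le (hle k)]; exact hsub k hk)).intervalIntegrable
  have hsplit : ∫ x in (0 : ℝ)..1, g x = ∑ k ∈ Finset.range n, ∫ x in a k..a (k + 1), g x := by
    rw [intervalIntegral.sum_integral_adjacent_intervals hint]
    simp [ha, hn0.ne']
  have hpiece (k : ℕ) (hk : k < n) :
      |g (a k) / n - ∫ x in a k..a (k + 1), g x| ≤ ε / 2 * (n : ℝ)⁻¹ := by
    have hconst : g (a k) / n = ∫ _ in a k..a (k + 1), g (a k) := by
      rw [intervalIntegral.integral_const, hstep, smul_eq_mul]; ring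
    rw [hconst, ← intervalIntegral.integral_sub (by simp) (hint k hk), ← Real.norm_eq_abs]
    refine (intervalIntegral.norm_integral_le_of_norm_le_const (C := ε / 2) fun x hx => ?_).trans_eq
      (by rw [hstep, abs_of_pos (inv_pos.mpr hn0)])
    rw [Set.uIoc_of_le (hle k)] at hx
    refine (hgδ (a k) (hsub k hk ⟨le_rfl, hle k⟩) x (hsub k hk ⟨hx.1.le, hx.2⟩) ?_).le
    rw [Real.dist_eq, abs_sub_lt_iff]
    constructor <;> linarith [hx.1, hx.2, hstep k]
  rw [Fin.sum_univ_eq_sum_range (fun k => g (a k)) n, hsplit, Finset.sum_div, Real.dist_eq,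
    ← Finset.sum_sub_distrib]
  calc _ ≤ ∑ k ∈ Finset.range n, ε / 2 * (n : ℝ)⁻¹ :=
        (Finset.abs_sum_le_sum_abs _ _).trans
          (Finset.sum_le_sum fun k hk => hpiece k (Finset.mem_range.mp hk))
    _ = ε / 2 := by simp; field_simp
    _ < ε := half_lt_self hε

/-- The sum of `K` over the residue class of `m` modulo `N`. -/
noncomputable def residueSum (K : ℤ → ℝ) (N : ℕ) (m : ℤ) : ℝ :=
  ∑' l : ℤ, if (N : ℤ) ∣ l - m then K l else 0

theorem summable_mul_of_abs_le {K w : ℤ → ℝ} {C : ℝ} (hK : Summable fun m => |K m|)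
    (hw : ∀ m, |w m| ≤ C) : Summable fun m => K m * w m :=
  (hK.mul_right C).of_norm_bounded fun m => by
    rw [Real.norm_eq_abs, abs_mul]
    exact mul_le_mul_of_nonneg_left (hw m) (abs_nonneg _)

theorem summable_ite_of_summable_abs {K : ℤ → ℝ} (hK : Summable fun m => |K m|) (p : ℤ → Prop)
    [DecidablePred p] : Summable fun m => if p m then K m else 0 :=
  hK.of_norm_bounded fun m => by
    split_ifs <;> simp

theorem continuous_spectrum' {K : ℤ → ℝ} (hK : Summable fun m => |K m|) :
    Continuous (spectrum' K) := by
  refine continuous_tsum (fun m => by fun_prop) hK fun m f => ?_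
  rw [Real.norm_eq_abs, abs_mul]
  exact mul_le_of_le_one_right (abs_nonneg _) (Real.abs_cos_le_one _)

theorem sum_spectrum'_mul {K : ℤ → ℝ} (hK : Summable fun m => |K m|) (N : ℕ) (w : Fin N → ℝ) :
    ∑ k : Fin N, spectrum' K ((k : ℝ) / N) * w k =
      ∑' l : ℤ, K l * ∑ k : Fin N, Real.cos (2 * Real.pi * ((k : ℝ) / N) * l) * w k := by
  simp_rw [spectrum', ← tsum_mul_right, Finset.mul_sum]
  rw [Summable.tsum_finsetSum]
  · simp_rw [mul_assoc]
  · intro k _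
    simp_rw [← mul_assoc]
    exact (summable_mul_of_abs_le hK fun m => Real.abs_cos_le_one _).mul_right _

theorem sum_spectrum'_mul_sin {K : ℤ → ℝ} (hK : Summable fun m => |K m|) {N : ℕ} (hN : N ≠ 0)
    (m : ℤ) :
    ∑ k : Fin N, spectrum' K ((k : ℝ) / N) * Real.sin (2 * Real.pi * ((k : ℝ) / N) * m) = 0 := by
  rw [sum_spectrum'_mul hK]
  have h (l : ℤ) : ∑ k : Fin N, Real.cos (2 * Real.pi * ((k : ℝ) / N) * l) *
      Real.sin (2 * Real.pi * ((k : ℝ) / N) * m) = 0 := by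
    have h1 := sum_sin_two_pi hN (m + l)
    have h2 := sum_sin_two_pi hN (m - l)
    push_cast at h1 h2
    simp_rw [mul_add, Real.sin_add, Finset.sum_add_distrib] at h1
    simp_rw [mul_sub, Real.sin_sub, Finset.sum_sub_distrib] at h2
    rw [Finset.sum_congr rfl fun k _ => mul_comm _ _]
    linarith
  simp [h]

theorem sum_cos_mul_cos_two_pi {N : ℕ} (hN : N ≠ 0) (l m : ℤ) :
    ∑ k : Fin N, Real.cos (2 * Real.pi * ((k : ℝ) / N) * l) *
      Real.cos (2 * Real.pi * ((k : ℝ) / N) * m) =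
      ((if (N : ℤ) ∣ l - m then (N : ℝ) else 0) + if (N : ℤ) ∣ l + m then (N : ℝ) else 0) / 2 := by
  rw [← sum_cos_two_pi hN, ← sum_cos_two_pi hN, ← Finset.sum_add_distrib, Finset.sum_div]
  refine Finset.sum_congr rfl fun k _ => ?_
  push_cast
  rw [mul_add, mul_sub, Real.cos_add, Real.cos_sub]
  ring

theorem sum_spectrum'_mul_cos {K : ℤ → ℝ} (hK_even : ∀ m, K (-m) = K m)
    (hK : Summable fun m => |K m|) {N : ℕ} (hN : N ≠ 0) (m : ℤ) :
    ∑ k : Fin N, spectrum' K ((k : ℝ) / N) * Real.cos (2 * Real.pi * ((k : ℝ) / N) * m) =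
      N * residueSum K N m := by
  rw [sum_spectrum'_mul hK]
  set g : ℤ → ℝ := fun l => if (N : ℤ) ∣ l - m then K l else 0 with hg
  have h (l : ℤ) : K l * ∑ k : Fin N, Real.cos (2 * Real.pi * ((k : ℝ) / N) * l) *
      Real.cos (2 * Real.pi * ((k : ℝ) / N) * m) = N / 2 * (g l + g (-l)) := by
    have hd : ((N : ℤ) ∣ -l - m) ↔ (N : ℤ) ∣ l + m := by
      rw [← dvd_neg]; ring_nf
    simp only [hg]
    rw [sum_cos_mul_cos_two_pi hN, hK_even, if_congr hd rfl rfl]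
    split_ifs <;> ring
  have hs : Summable g := summable_ite_of_summable_abs hK fun l => (N : ℤ) ∣ l - m
  have hs' : Summable fun l => g (-l) := hs.comp_injective neg_injective
  have he : ∑' l, g (-l) = ∑' l, g l := (Equiv.neg ℤ).tsum_eq g
  rw [tsum_congr h, tsum_mul_left, hs.tsum_add hs', he, residueSum]
  ring

/-- The first `n` rows of the orthogonal matrix of the discrete Hartley transform of order `N`. -/
noncomputable def hartley (n N : ℕ) : Matrix (Fin n) (Fin N) ℝ :=
  of fun i k => (Real.cos (2 * Real.pi * ((k : ℝ) / N) * i) +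
    Real.sin (2 * Real.pi * ((k : ℝ) / N) * i)) / √N

theorem hartley_mul_diagonal_mul_transpose (n N : ℕ) (d : Fin N → ℝ) (i j : Fin n) :
    (hartley n N * diagonal d * (hartley n N)ᵀ) i j =
      (∑ k : Fin N, d k * Real.cos (2 * Real.pi * ((k : ℝ) / N) * ((i : ℤ) - (j : ℤ) : ℤ)) +
        ∑ k : Fin N, d k * Real.sin (2 * Real.pi * ((k : ℝ) / N) * ((i : ℤ) + (j : ℤ) : ℤ))) / N := by
  rw [mul_apply, ← Finset.sum_add_distrib, Finset.sum_div]
  refine Finset.sum_congr rfl fun k _ => ?_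
  have hN : √(N : ℝ) * √N = N := Real.mul_self_sqrt (Nat.cast_nonneg N)
  rw [mul_diagonal, transpose_apply, hartley, of_apply, of_apply]
  push_cast
  rw [mul_sub, mul_add, Real.cos_sub, Real.sin_add]
  rw [div_mul_eq_mul_div, div_mul_div_comm, hN]
  ring

theorem hartley_mul_transpose {n N : ℕ} (hN : N ≠ 0) (hn : n ≤ N) :
    hartley n N * (hartley n N)ᵀ = 1 := by
  ext i j
  have h := hartley_mul_diagonal_mul_transpose n N (fun _ => 1) i j
  simp only [one_mul, sum_cos_two_pi hN, sum_sin_two_pi hN, diagonal_one, Matrix.mul_one] at h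
  rw [h, one_apply]
  have hN' : (N : ℝ) ≠ 0 := Nat.cast_ne_zero.mpr hN
  have hij : ((N : ℤ) ∣ (i : ℤ) - (j : ℤ)) ↔ i = j := by
    refine ⟨fun hd => ?_, fun hij => by simp [hij]⟩
    have := Int.eq_zero_of_abs_lt_dvd hd (by rw [abs_lt]; omega)
    omega
  simp only [hij]
  split_ifs <;> simp [hN']

theorem toeplitz_residueSum_eq {K : ℤ → ℝ} (hK_even : ∀ m, K (-m) = K m)
    (hK : Summable fun m => |K m|) (n : ℕ) {N : ℕ} (hN : N ≠ 0) :
    toeplitz (residueSum K N) n =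
      hartley n N * diagonal (fun k : Fin N => spectrum' K ((k : ℝ) / N)) * (hartley n N)ᵀ := by
  ext i j
  have hN' : (N : ℝ) ≠ 0 := Nat.cast_ne_zero.mpr hN
  rw [hartley_mul_diagonal_mul_transpose, sum_spectrum'_mul_cos hK_even hK hN,
    sum_spectrum'_mul_sin hK hN, toeplitz]
  field_simp
  simp

theorem natCast_div_mem_Icc {N : ℕ} (k : Fin N) : (k : ℝ) / N ∈ Set.Icc (0 : ℝ) 1 :=
  ⟨by positivity, div_le_one_of_le₀ (by exact_mod_cast k.2.le) (Nat.cast_nonneg N)⟩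

theorem le_dotProduct_toeplitz_residueSum {K : ℤ → ℝ} (hK_even : ∀ m, K (-m) = K m)
    (hK : Summable fun m => |K m|) {c : ℝ} (hS : ∀ f ∈ Set.Icc (0 : ℝ) 1, c ≤ spectrum' K f)
    {n N : ℕ} (hN : N ≠ 0) (hn : n ≤ N) (x : Fin n → ℝ) :
    c * (x ⬝ᵥ x) ≤ x ⬝ᵥ toeplitz (residueSum K N) n *ᵥ x := by
  have hquad (d : Fin N → ℝ) : x ⬝ᵥ (hartley n N * diagonal d * (hartley n N)ᵀ) *ᵥ x =
      ∑ k, d k * (((hartley n N)ᵀ *ᵥ x) k * ((hartley n N)ᵀ *ᵥ x) k) := by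
    rw [← mulVec_mulVec, ← mulVec_mulVec, dotProduct_mulVec, ← mulVec_transpose]
    simp only [dotProduct, mulVec_diagonal]
    exact Finset.sum_congr rfl fun k _ => by ring
  have h1 := hquad fun _ => 1
  rw [diagonal_one, Matrix.mul_one, hartley_mul_transpose hN hn, one_mulVec] at h1
  rw [toeplitz_residueSum_eq hK_even hK n hN, hquad, h1, Finset.mul_sum]
  refine Finset.sum_le_sum fun k _ => ?_
  rw [one_mul]
  exact mul_le_mul_of_nonneg_right (hS _ (natCast_div_mem_Icc k)) (mul_self_nonneg _)

theorem tendsto_residueSum {K : ℤ → ℝ} (hK : Summable fun m => |K m|) (m : ℤ) :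
    Tendsto (fun N => residueSum K N m) atTop (nhds (K m)) := by
  rw [← tsum_ite_eq m K]
  refine tendsto_tsum_of_dominated_convergence hK (fun l => ?_) (.of_forall fun N l => ?_)
  · refine tendsto_const_nhds.congr' ?_
    filter_upwards [eventually_gt_atTop (l - m).natAbs] with N hN
    refine if_congr ⟨fun h => by simp [h], fun h => ?_⟩ rfl rfl
    have := Int.eq_zero_of_abs_lt_dvd h (by rw [Int.abs_eq_natAbs]; omega)
    omega
  · split_ifs <;> simp

theorem le_dotProduct_toeplitz {K : ℤ → ℝ} (hK_even : ∀ m, K (-m) = K m)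
    (hK : Summable fun m => |K m|) {c : ℝ} (hS : ∀ f ∈ Set.Icc (0 : ℝ) 1, c ≤ spectrum' K f)
    {n : ℕ} (x : Fin n → ℝ) : c * (x ⬝ᵥ x) ≤ x ⬝ᵥ toeplitz K n *ᵥ x := by
  have hlim : Tendsto (fun N => x ⬝ᵥ toeplitz (residueSum K N) n *ᵥ x) atTop
      (nhds (x ⬝ᵥ toeplitz K n *ᵥ x)) := by
    simp only [dotProduct, mulVec, toeplitz]
    exact tendsto_finsetSum _ fun i _ => (tendsto_finsetSum _ fun j _ =>
      (tendsto_residueSum hK _).mul_const _).const_mul _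
  refine ge_of_tendsto hlim ?_
  filter_upwards [eventually_ge_atTop n, eventually_ne_atTop 0] with N hn hN
  exact le_dotProduct_toeplitz_residueSum hK_even hK hS hN hn x

theorem residueSum_neg {K : ℤ → ℝ} (hK_even : ∀ m, K (-m) = K m) (N : ℕ) (m : ℤ) :
    residueSum K N (-m) = residueSum K N m := by
  rw [residueSum, ← (Equiv.neg ℤ).tsum_eq]
  refine tsum_congr fun l => ?_
  rw [Equiv.neg_apply, hK_even]
  refine if_congr ?_ rfl rfl
  rw [← dvd_neg]; ring_nf

theorem toeplitz_isSymm {K : ℤ → ℝ} (hK_even : ∀ m, K (-m) = K m) (n : ℕ) :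
    (toeplitz K n).IsSymm := by
  ext i j
  rw [transpose_apply, toeplitz, toeplitz, ← hK_even, neg_sub]

theorem det_toeplitz_residueSum {K : ℤ → ℝ} (hK_even : ∀ m, K (-m) = K m)
    (hK : Summable fun m => |K m|) {n : ℕ} (hn : n ≠ 0) :
    (toeplitz (residueSum K n) n).det = ∏ k : Fin n, spectrum' K ((k : ℝ) / n) := by
  have h := congrArg det (hartley_mul_transpose hn le_rfl)
  rw [det_mul, det_one] at h
  rw [toeplitz_residueSum_eq hK_even hK n hn, det_mul_right_comm, det_mul, det_mul, h, one_mul,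
    det_diagonal]

/-- The entries of an `n × n` Toeplitz matrix congruent to the `l`-th diagonal modulo `n`, but not
on it. -/
def wrappedEntries (n : ℕ) (l : ℤ) : Finset (Fin n × Fin n) :=
  {p | (n : ℤ) ∣ l - ((p.1 : ℤ) - p.2) ∧ l ≠ (p.1 : ℤ) - p.2}

theorem injOn_wrappedEntries (n : ℕ) (l : ℤ) :
    Set.InjOn (fun p : Fin n × Fin n => (p.1 : ℤ)) (wrappedEntries n l) := by
  rintro ⟨i, j⟩ hp ⟨i', j'⟩ hq (h : (i : ℤ) = i')
  simp only [wrappedEntries, Finset.coe_filter, Finset.mem_univ, true_and, Set.mem_ofPred_eq]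
    at hp hq
  have := Int.eq_zero_of_abs_lt_dvd (dvd_sub hp.1 hq.1) (by rw [abs_lt]; omega)
  ext <;> simp <;> omega

theorem card_wrappedEntries_le (n : ℕ) (l : ℤ) : (wrappedEntries n l).card ≤ n := by
  refine (Finset.card_le_card_of_injOn (t := Finset.Ico (0 : ℤ) n) _ (fun p _ => ?_)
    (injOn_wrappedEntries n l)).trans (by simp)
  simp

theorem card_wrappedEntries_le_two_mul (n : ℕ) (l : ℤ) :
    (wrappedEntries n l).card ≤ 2 * l.natAbs := by
  refine (Finset.card_le_card_of_injOn
    (t := Finset.Ico (0 : ℤ) l.natAbs ∪ Finset.Ico ((n : ℤ) - l.natAbs) n) _ ?_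
    (injOn_wrappedEntries n l)).trans ((Finset.card_union_le _ _).trans (by
      simp only [Int.card_Ico]; omega))
  rintro ⟨i, j⟩ hp
  simp only [wrappedEntries, Finset.coe_filter, Finset.mem_univ, true_and, Set.mem_ofPred_eq] at hp
  simp only [Finset.coe_union, Finset.coe_Ico, Set.mem_union, Set.mem_Ico]
  by_contra! hcon
  have := Int.eq_zero_of_abs_lt_dvd hp.1 (by rw [abs_lt]; omega)
  omega

theorem abs_sub_residueSum_le {K : ℤ → ℝ} (hK : Summable fun m => |K m|) (n : ℕ) (m : ℤ) :
    |K m - residueSum K n m| ≤ ∑' l : ℤ, if (n : ℤ) ∣ l - m ∧ l ≠ m then |K l| else 0 := by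
  have hs := summable_ite_of_summable_abs hK fun l => (n : ℤ) ∣ l - m
  have hm := summable_ite_of_summable_abs hK fun l => l = m
  have habs : Summable fun m => |(|K m|)| := by simpa using hK
  rw [abs_sub_comm, residueSum, ← tsum_ite_eq m K, ← hs.tsum_sub hm, ← Real.norm_eq_abs]
  refine tsum_of_norm_bounded
    (summable_ite_of_summable_abs habs fun l => (n : ℤ) ∣ l - m ∧ l ≠ m).hasSum fun l => ?_
  by_cases hl : l = m
  · simp [hl]
  · by_cases hd : (n : ℤ) ∣ l - m <;> simp [hl, hd]

theorem sum_abs_toeplitz_sub_le {K : ℤ → ℝ} (hK : Summable fun m => |K m|) (n : ℕ) :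
    ∑ i, ∑ j, |toeplitz K n i j - toeplitz (residueSum K n) n i j| ≤
      ∑' l : ℤ, |K l| * (wrappedEntries n l).card := by
  have habs : Summable fun m => |(|K m|)| := by simpa using hK
  calc _ ≤ ∑ i : Fin n, ∑ j : Fin n, ∑' l : ℤ,
        if (n : ℤ) ∣ l - ((i : ℤ) - j) ∧ l ≠ (i : ℤ) - j then |K l| else 0 :=
        Finset.sum_le_sum fun i _ => Finset.sum_le_sum fun j _ =>
          abs_sub_residueSum_le hK n ((i : ℤ) - j)
    _ = ∑ p : Fin n × Fin n, ∑' l : ℤ, if p ∈ wrappedEntries n l then |K l| else 0 := by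
        simp only [Fintype.sum_prod_type, wrappedEntries, Finset.mem_filter, Finset.mem_univ,
          true_and]
    _ = _ := by
        rw [← Summable.tsum_finsetSum fun p _ => summable_ite_of_summable_abs habs fun l =>
          p ∈ wrappedEntries n l]
        refine tsum_congr fun l => ?_
        rw [Finset.sum_ite_mem, Finset.univ_inter, Finset.sum_const, nsmul_eq_mul, mul_comm]

theorem tendsto_sum_abs_toeplitz_sub {K : ℤ → ℝ} (hK : Summable fun m => |K m|) :
    Tendsto (fun n : ℕ =>
      (∑ i, ∑ j, |toeplitz K n i j - toeplitz (residueSum K n) n i j|) / (n : ℝ))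
      atTop (nhds 0) := by
  have hlim : Tendsto (fun n : ℕ => ∑' l : ℤ, |K l| * ((wrappedEntries n l).card / (n : ℝ))) atTop
      (nhds (∑' _ : ℤ, (0 : ℝ))) := by
    refine tendsto_tsum_of_dominated_convergence hK (fun l => ?_) (.of_forall fun n l => ?_)
    · rw [← mul_zero |K l|]
      refine Tendsto.const_mul _ ?_
      refine squeeze_zero (fun n => by positivity) (fun n => ?_)
        (tendsto_const_div_atTop_nhds_zero_nat ((2 * l.natAbs : ℕ) : ℝ))
      exact div_le_div_of_nonneg_right (by exact_mod_cast card_wrappedEntries_le_two_mul n l)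
        (Nat.cast_nonneg n)
    · rw [Real.norm_eq_abs, abs_mul, abs_abs]
      refine mul_le_of_le_one_right (abs_nonneg _) ?_
      rw [abs_of_nonneg (by positivity)]
      exact div_le_one_of_le₀ (by exact_mod_cast card_wrappedEntries_le n l) (Nat.cast_nonneg n)
  rw [tsum_zero] at hlim
  refine squeeze_zero (fun n => by positivity) (fun n => ?_) hlim
  simp_rw [← mul_div_assoc]
  rw [tsum_div_const]
  exact div_le_div_of_nonneg_right (sum_abs_toeplitz_sub_le hK n) (Nat.cast_nonneg n)

/-- **Szegő limit for the log-determinant.** If the spectrum `S` of an even, absolutely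
summable auto-covariance `K` satisfies `0 < c ≤ S(f) ≤ M` on `[0,1]`, then
`(1/n) ln det Λ⁽ⁿ⁾ → ∫₀¹ ln S(f) df` for the symmetric Toeplitz matrices `Λ⁽ⁿ⁾`. -/
theorem toeplitz_log_det_tendsto
    (K : ℤ → ℝ) (hK_even : ∀ m, K (-m) = K m)
    (hK_sum : Summable fun m : ℤ => |K m|)
    (c M : ℝ) (hc : 0 < c) (hcM : c ≤ M)
    (hS : ∀ f ∈ Set.Icc (0 : ℝ) 1, c ≤ spectrum' K f ∧ spectrum' K f ≤ M) :
    Tendsto (fun n : ℕ => Real.log (toeplitz K n).det / (n : ℝ))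
      atTop (nhds (∫ f in (0 : ℝ)..1, Real.log (spectrum' K f))) := by
  have hSc : ∀ f ∈ Set.Icc (0 : ℝ) 1, c ≤ spectrum' K f := fun f hf => (hS f hf).1
  have hR : Tendsto (fun n : ℕ => (∑ k : Fin n, Real.log (spectrum' K ((k : ℝ) / n))) / n) atTop
      (nhds (∫ f in (0 : ℝ)..1, Real.log (spectrum' K f))) :=
    tendsto_riemann_sum <| (continuous_spectrum' hK_sum).continuousOn.log
      fun f hf => (hc.trans_le (hSc f hf)).ne'
  refine tendsto_of_tendsto_of_dist hR ?_
  have hE := (tendsto_sum_abs_toeplitz_sub hK_sum).const_mul c⁻¹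
  rw [mul_zero] at hE
  refine squeeze_zero' (.of_forall fun n => dist_nonneg) ?_ hE
  filter_upwards [eventually_ne_atTop 0] with n hn
  have hT := le_dotProduct_toeplitz hK_even hK_sum hSc (n := n)
  have hC := le_dotProduct_toeplitz_residueSum hK_even hK_sum hSc hn le_rfl
  have hTp := posDef_of_le hc (toeplitz_isSymm hK_even n) hT
  have hCp := posDef_of_le hc (toeplitz_isSymm (residueSum_neg hK_even n) n) hC
  have h1 := log_det_sub_le_sum_abs hc hTp hCp hC
  have h2 := log_det_sub_le_sum_abs hc hCp hTp hT
  simp_rw [abs_sub_comm (toeplitz (residueSum K n) n _ _)] at h2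
  rw [← Real.log_prod fun k _ => (hc.trans_le (hSc _ (natCast_div_mem_Icc k))).ne',
    ← det_toeplitz_residueSum hK_even hK_sum hn, Real.dist_eq, ← sub_div, abs_div, Nat.abs_cast,
    ← mul_div_assoc]
  exact div_le_div_of_nonneg_right (abs_sub_le_iff.mpr ⟨h2, h1⟩) (Nat.cast_nonneg n)
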